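/- I_+ equals the set of A_+-linear combinations of the elements x^γ + y^γ with γ ∈ {0,1}^t, γ ≠ 0; that is, as an ideal of the fixed subring A_+, I_+ is generated by the elements x^γ + y^γ for γ ∈ {0,1}^t − {0}. In particular I_+ is a finitely generated ideal of A_+ with a generating set of 2^t − 1 elements. (Lemma 2.7.) -/

import Mathlib

noncomputable section

open MvPolynomial

/-- The defining ideal: generated by `x_i y_i + x_i + y_i`, `i = 1,…,t`. -/
def torusRel (R : Type*) [CommRing R] (t : ℕ) : Ideal (MvPolynomial (Fin t ⊕ Fin t) R) :=
  Ideal.span { p | ∃ i : Fin t,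
    p = X (Sum.inl i) * X (Sum.inr i) + X (Sum.inl i) + X (Sum.inr i) }

/-- `A = R[x_1,…,x_t,y_1,…,y_t]/(x_i y_i + x_i + y_i)`. -/
abbrev QA (R : Type*) [CommRing R] (t : ℕ) :=
  MvPolynomial (Fin t ⊕ Fin t) R ⧸ torusRel R t

/-- The image of the variable `x_i` in `A`. -/
def xg (R : Type*) [CommRing R] (t : ℕ) (i : Fin t) : QA R t :=
  Ideal.Quotient.mk _ (X (Sum.inl i))

/-- The image of the variable `y_i` in `A`. -/
def yg (R : Type*) [CommRing R] (t : ℕ) (i : Fin t) : QA R t :=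
  Ideal.Quotient.mk _ (X (Sum.inr i))

/-- `L = R[ℤ^t]`, the group algebra of `ℤ^t` over `R`. -/
abbrev LA (R : Type*) [CommRing R] (t : ℕ) := AddMonoidAlgebra R (Fin t → ℤ)

/-- The basis element `u^ν` of `L = R[ℤ^t]`. -/
def uL (R : Type*) [CommRing R] (t : ℕ) (ν : Fin t → ℤ) : LA R t :=
  AddMonoidAlgebra.single ν 1

/-- The ideal `I_A ⊆ A` generated by `x_1,…,x_t,y_1,…,y_t`. -/
def IA (R : Type*) [CommRing R] (t : ℕ) : Ideal (QA R t) :=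
  Ideal.span (Set.range (xg R t) ∪ Set.range (yg R t))

/-- `x^λ = ∏_i x_i^{λ_i}` in `A`. -/
def xpow (R : Type*) [CommRing R] (t : ℕ) (lam : Fin t → ℕ) : QA R t :=
  ∏ i : Fin t, xg R t i ^ lam i

/-- `y^λ = ∏_i y_i^{λ_i}` in `A`. -/
def ypow (R : Type*) [CommRing R] (t : ℕ) (lam : Fin t → ℕ) : QA R t :=
  ∏ i : Fin t, yg R t i ^ lam i

theorem xg_mul_yg (R : Type*) [CommRing R] (t : ℕ) (i : Fin t) :
    xg R t i * yg R t i + xg R t i + yg R t i = 0 := by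
  unfold xg yg
  rw [← map_mul, ← map_add, ← map_add, Ideal.Quotient.eq_zero_iff_mem]
  exact Ideal.subset_span ⟨i, rfl⟩

/-- The subalgebra `A_+` of `τ`-fixed elements. -/
def fixedSubalgebra {R : Type*} [CommRing R] {t : ℕ} (τ : QA R t ≃ₐ[R] QA R t) :
    Subalgebra R (QA R t) :=
  AlgHom.equalizer (τ : QA R t →ₐ[R] QA R t) (AlgHom.id R (QA R t))

theorem mem_fixedSubalgebra {R : Type*} [CommRing R] {t : ℕ} {τ : QA R t ≃ₐ[R] QA R t}
    {a : QA R t} : a ∈ fixedSubalgebra τ ↔ τ a = a := Iff.rfl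

/-- The trace `a ↦ a + τ a`, as an `A_+`-linear map. -/
def traceMap {R : Type*} [CommRing R] {t : ℕ} (τ : QA R t ≃ₐ[R] QA R t) :
    QA R t →ₗ[fixedSubalgebra τ] QA R t where
  toFun a := a + τ a
  map_add' a b := by rw [map_add]; ring
  map_smul' c a := by
    have hc : τ (c : QA R t) = c := c.2
    simp only [Subalgebra.smul_def, smul_eq_mul, map_mul, hc, RingHom.id_apply]
    ring

theorem traceMap_apply {R : Type*} [CommRing R] {t : ℕ} (τ : QA R t ≃ₐ[R] QA R t) (a : QA R t) :
    traceMap τ a = a + τ a := rfl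

/-- The `A_+`-submodule of `A` generated by the squarefree monomials in the `x_i` other than `1`
and by the elements `x_i + y_i`. -/
def squarefreeSpan {R : Type*} [CommRing R] {t : ℕ} (τ : QA R t ≃ₐ[R] QA R t) :
    Submodule (fixedSubalgebra τ) (QA R t) :=
  Submodule.span _ ({a | ∃ S : Finset (Fin t), S.Nonempty ∧ a = ∏ i ∈ S, xg R t i} ∪
    Set.range fun i => xg R t i + yg R t i)

section Involution

variable {R : Type*} [CommRing R] {t : ℕ} {τ : QA R t ≃ₐ[R] QA R t}

theorem xg_add_yg_mem_fixedSubalgebra (hτx : ∀ i, τ (xg R t i) = yg R t i)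
    (hτy : ∀ i, τ (yg R t i) = xg R t i) (i : Fin t) :
    xg R t i + yg R t i ∈ fixedSubalgebra τ := by
  rw [mem_fixedSubalgebra, map_add, hτx, hτy, add_comm]

theorem prod_xg_mem_squarefreeSpan {S : Finset (Fin t)} (hS : S.Nonempty) :
    ∏ i ∈ S, xg R t i ∈ squarefreeSpan τ :=
  Submodule.subset_span (Or.inl ⟨S, hS, rfl⟩)

theorem xg_mem_squarefreeSpan (i : Fin t) : xg R t i ∈ squarefreeSpan τ := by
  simpa using prod_xg_mem_squarefreeSpan (τ := τ) (Finset.singleton_nonempty i)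

theorem xg_add_yg_mem_squarefreeSpan (i : Fin t) :
    xg R t i + yg R t i ∈ squarefreeSpan τ :=
  Submodule.subset_span (Or.inr ⟨i, rfl⟩)

theorem mul_mem_squarefreeSpan_of_fixed {c a : QA R t} (hc : c ∈ fixedSubalgebra τ)
    (ha : a ∈ squarefreeSpan τ) : c * a ∈ squarefreeSpan τ :=
  Submodule.smul_mem _ (⟨c, hc⟩ : fixedSubalgebra τ) ha

theorem xg_mul_mem_squarefreeSpan (hτx : ∀ i, τ (xg R t i) = yg R t i)
    (hτy : ∀ i, τ (yg R t i) = xg R t i) (j : Fin t) {a : QA R t}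
    (ha : a ∈ squarefreeSpan τ) : xg R t j * a ∈ squarefreeSpan τ := by
  have hfix := xg_add_yg_mem_fixedSubalgebra hτx hτy
  induction ha using Submodule.span_induction with
  | mem a ha =>
    rcases ha with ⟨S, hS, rfl⟩ | ⟨i, rfl⟩
    · by_cases hj : j ∈ S
      · have hsq : xg R t j * ∏ i ∈ S, xg R t i =
            (xg R t j + yg R t j) * ∏ i ∈ S.erase j, xg R t i +
              (xg R t j + yg R t j) * ∏ i ∈ S, xg R t i := by
          rw [← Finset.mul_prod_erase S _ hj]
          linear_combination (-∏ i ∈ S.erase j, xg R t i) * xg_mul_yg R t j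
        rw [hsq]
        refine add_mem ?_
          (mul_mem_squarefreeSpan_of_fixed (hfix j) (prod_xg_mem_squarefreeSpan hS))
        rcases (S.erase j).eq_empty_or_nonempty with h | h
        · simpa [h] using xg_add_yg_mem_squarefreeSpan j
        · exact mul_mem_squarefreeSpan_of_fixed (hfix j) (prod_xg_mem_squarefreeSpan h)
      · rw [← Finset.prod_insert hj]
        exact prod_xg_mem_squarefreeSpan (Finset.insert_nonempty _ _)
    · rw [mul_comm]
      exact mul_mem_squarefreeSpan_of_fixed (hfix i) (xg_mem_squarefreeSpan j)
  | zero => simp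
  | add a b _ _ ha hb => rw [mul_add]; exact add_mem ha hb
  | smul c a _ ha => rw [mul_smul_comm]; exact Submodule.smul_mem _ c ha

theorem mul_mem_squarefreeSpan (hτx : ∀ i, τ (xg R t i) = yg R t i)
    (hτy : ∀ i, τ (yg R t i) = xg R t i) (b : QA R t) {a : QA R t}
    (ha : a ∈ squarefreeSpan τ) : b * a ∈ squarefreeSpan τ := by
  obtain ⟨p, rfl⟩ := Ideal.Quotient.mk_surjective b
  induction p using MvPolynomial.induction_on generalizing a with
  | C r =>
    exact mul_mem_squarefreeSpan_of_fixed ((fixedSubalgebra τ).algebraMap_mem r) ha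
  | add p q hp hq => rw [map_add, add_mul]; exact add_mem (hp ha) (hq ha)
  | mul_X p i hp =>
    rw [map_mul, mul_assoc]
    refine hp ?_
    rcases i with i | i
    · exact xg_mul_mem_squarefreeSpan hτx hτy i ha
    · have hy : yg R t i * a = (xg R t i + yg R t i) * a - xg R t i * a := by ring
      change yg R t i * a ∈ _
      rw [hy]
      exact sub_mem
        (mul_mem_squarefreeSpan_of_fixed (xg_add_yg_mem_fixedSubalgebra hτx hτy i) ha)
        (xg_mul_mem_squarefreeSpan hτx hτy i ha)

theorem mem_squarefreeSpan_of_mem_IA (hτx : ∀ i, τ (xg R t i) = yg R t i)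
    (hτy : ∀ i, τ (yg R t i) = xg R t i) {a : QA R t} (ha : a ∈ IA R t) :
    a ∈ squarefreeSpan τ := by
  induction ha using Submodule.span_induction with
  | mem a ha =>
    rcases ha with ⟨i, rfl⟩ | ⟨i, rfl⟩
    · exact xg_mem_squarefreeSpan i
    · rw [← add_sub_cancel_left (xg R t i) (yg R t i)]
      exact sub_mem (xg_add_yg_mem_squarefreeSpan i) (xg_mem_squarefreeSpan i)
  | zero => exact zero_mem _
  | add a b _ _ ha hb => exact add_mem ha hb
  | smul b a _ ha => exact mul_mem_squarefreeSpan hτx hτy b ha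

theorem traceMap_mem_span (hτx : ∀ i, τ (xg R t i) = yg R t i)
    (hτy : ∀ i, τ (yg R t i) = xg R t i) {a : QA R t} (ha : a ∈ IA R t) :
    traceMap τ a ∈ Submodule.span (fixedSubalgebra τ)
      {b | ∃ S : Finset (Fin t), S.Nonempty ∧ b = traceMap τ (∏ i ∈ S, xg R t i)} := by
  have hx (S : Finset (Fin t)) (hS : S.Nonempty) : traceMap τ (∏ i ∈ S, xg R t i) ∈
      Submodule.span (fixedSubalgebra τ)
        {b | ∃ S : Finset (Fin t), S.Nonempty ∧ b = traceMap τ (∏ i ∈ S, xg R t i)} :=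
    Submodule.subset_span ⟨S, hS, rfl⟩
  refine Submodule.span_le (p := Submodule.comap (traceMap τ) (Submodule.span _ _)).2 ?_
    (mem_squarefreeSpan_of_mem_IA hτx hτy ha)
  rintro _ (⟨S, hS, rfl⟩ | ⟨i, rfl⟩)
  · exact hx S hS
  · have he : traceMap τ (xg R t i + yg R t i) =
        traceMap τ (xg R t i) + traceMap τ (xg R t i) := by
      simp only [traceMap_apply, map_add, hτx, hτy]
      ring
    have h := hx {i} (Finset.singleton_nonempty i)
    rw [Finset.prod_singleton] at h
    rw [SetLike.mem_coe, Submodule.mem_comap, he]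
    exact add_mem h h

end Involution

/-- The unit `u_i = 1 + x_i` of `A`, with inverse `1 + y_i`. -/
def unitA (R : Type*) [CommRing R] (t : ℕ) (i : Fin t) : (QA R t)ˣ where
  val := 1 + xg R t i
  inv := 1 + yg R t i
  val_inv := by linear_combination xg_mul_yg R t i
  inv_val := by linear_combination xg_mul_yg R t i

/-- The unit `u^ν = ∏_i u_i^{ν_i}` of `A`. -/
def unitPow (R : Type*) [CommRing R] (t : ℕ) : Multiplicative (Fin t → ℤ) →* (QA R t)ˣ where
  toFun ν := ∏ i, unitA R t i ^ ν.toAdd i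
  map_one' := by simp
  map_mul' μ ν := by simp [zpow_add, Finset.prod_mul_distrib]

/-- The comparison map `L → A`, `u^ν ↦ u^ν`. -/
def ofLA (R : Type*) [CommRing R] (t : ℕ) : LA R t →ₐ[R] QA R t :=
  AddMonoidAlgebra.lift R (QA R t) (Fin t → ℤ) ((Units.coeHom (QA R t)).comp (unitPow R t))

theorem ofLA_uL (R : Type*) [CommRing R] (t : ℕ) (ν : Fin t → ℤ) :
    ofLA R t (uL R t ν) = unitPow R t (Multiplicative.ofAdd ν) := by
  simp [ofLA, uL]

/-- The comparison map `A → L`, `x_i ↦ u_i - 1`, `y_i ↦ u_i⁻¹ - 1`. -/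
def toLA (R : Type*) [CommRing R] (t : ℕ) : QA R t →ₐ[R] LA R t :=
  Ideal.Quotient.liftₐ (torusRel R t)
    (MvPolynomial.aeval (Sum.elim (fun i => uL R t (Pi.single i 1) - 1)
      fun i => uL R t (-Pi.single i 1) - 1)) (by
    have h : torusRel R t ≤ RingHom.ker (MvPolynomial.aeval (R := R)
        (Sum.elim (fun i => uL R t (Pi.single i 1) - 1)
          fun i => uL R t (-Pi.single i 1) - 1)) := by
      refine Ideal.span_le.2 ?_
      rintro _ ⟨i, rfl⟩
      have hu : uL R t (Pi.single i 1) * uL R t (-Pi.single i 1) = 1 := by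
        simp [uL, AddMonoidAlgebra.single_mul_single, AddMonoidAlgebra.one_def]
      simp only [SetLike.mem_coe, RingHom.mem_ker, map_add, map_mul, aeval_X, Sum.elim_inl,
        Sum.elim_inr]
      linear_combination hu
    exact fun a ha => h ha)

theorem toLA_xg (R : Type*) [CommRing R] (t : ℕ) (i : Fin t) :
    toLA R t (xg R t i) = uL R t (Pi.single i 1) - 1 := by
  change MvPolynomial.aeval _ (X (Sum.inl i)) = _
  simp

theorem toLA_yg (R : Type*) [CommRing R] (t : ℕ) (i : Fin t) :
    toLA R t (yg R t i) = uL R t (-Pi.single i 1) - 1 := by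
  change MvPolynomial.aeval _ (X (Sum.inr i)) = _
  simp

theorem QA_algHom_ext {R : Type*} [CommRing R] {t : ℕ} {B : Type*} [Semiring B] [Algebra R B]
    {f g : QA R t →ₐ[R] B} (hx : ∀ i, f (xg R t i) = g (xg R t i))
    (hy : ∀ i, f (yg R t i) = g (yg R t i)) : f = g := by
  refine Ideal.Quotient.algHom_ext _ (MvPolynomial.algHom_ext ?_)
  rintro (i | i)
  · exact hx i
  · exact hy i

theorem unitPow_ofAdd (R : Type*) [CommRing R] (t : ℕ) (ν : Fin t → ℤ) :
    unitPow R t (Multiplicative.ofAdd ν) = ∏ i, unitA R t i ^ ν i := rfl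

theorem unitPow_single (R : Type*) [CommRing R] (t : ℕ) (i : Fin t) :
    unitPow R t (Multiplicative.ofAdd (Pi.single i 1)) = unitA R t i := by
  simp [unitPow_ofAdd, Pi.single_apply]

theorem ofLA_toLA {R : Type*} [CommRing R] {t : ℕ} (a : QA R t) :
    ofLA R t (toLA R t a) = a := by
  have h : (ofLA R t).comp (toLA R t) = AlgHom.id R _ := by
    refine QA_algHom_ext (fun i => ?_) (fun i => ?_)
    · simp [toLA_xg, ofLA_uL, unitPow_single, unitA]
    · simp [toLA_yg, ofLA_uL, unitPow_single, unitA, ofAdd_neg]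
  exact DFunLike.congr_fun h a

/-- The involution of `L` with `u^ν ↦ u^{-ν}`. -/
def invLA (R : Type*) [CommRing R] (t : ℕ) : LA R t →ₐ[R] LA R t :=
  AddMonoidAlgebra.mapDomainAlgHom R R (-AddMonoidHom.id (Fin t → ℤ))

theorem invLA_uL (R : Type*) [CommRing R] (t : ℕ) (ν : Fin t → ℤ) :
    invLA R t (uL R t ν) = uL R t (-ν) := by
  simp [invLA, uL]

theorem toLA_involution {R : Type*} [CommRing R] {t : ℕ} {τ : QA R t ≃ₐ[R] QA R t}
    (hτx : ∀ i, τ (xg R t i) = yg R t i) (hτy : ∀ i, τ (yg R t i) = xg R t i) (a : QA R t) :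
    toLA R t (τ a) = invLA R t (toLA R t a) := by
  have h : (toLA R t).comp (τ : QA R t →ₐ[R] QA R t) = (invLA R t).comp (toLA R t) := by
    refine QA_algHom_ext (fun i => ?_) (fun i => ?_)
    · simp [hτx, toLA_xg, toLA_yg, invLA_uL]
    · simp [hτy, toLA_xg, toLA_yg, invLA_uL]
  exact DFunLike.congr_fun h a

/-- The augmentation of `L`. -/
def augLA (R : Type*) [CommRing R] (t : ℕ) : LA R t →ₐ[R] R :=
  AddMonoidAlgebra.lift R R (Fin t → ℤ) 1

theorem augLA_toLA {R : Type*} [CommRing R] {t : ℕ} {a : QA R t} (ha : a ∈ IA R t) :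
    augLA R t (toLA R t a) = 0 := by
  have h : IA R t ≤ RingHom.ker ((augLA R t).comp (toLA R t)) := by
    refine Ideal.span_le.2 ?_
    rintro _ (⟨i, rfl⟩ | ⟨i, rfl⟩)
    · simp [toLA_xg, augLA, uL]
    · simp [toLA_yg, augLA, uL]
  exact h ha

theorem prod_zpow_sub_one_mem {A ι : Type*} [CommRing A] [Fintype ι] {I : Ideal A} {v : ι → Aˣ}
    (hv : ∀ i, (v i : A) - 1 ∈ I) (n : ι → ℤ) : ((∏ i, v i ^ n i : Aˣ) : A) - 1 ∈ I := by
  have hi (i : ι) : Units.map (Ideal.Quotient.mk I : A →* A ⧸ I) (v i) = 1 :=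
    Units.ext (Ideal.Quotient.eq.2 (hv i))
  have h : Units.map (Ideal.Quotient.mk I : A →* A ⧸ I) (∏ i, v i ^ n i) = 1 := by
    simp only [map_prod, map_zpow, hi, one_zpow, Finset.prod_const_one]
  exact Ideal.Quotient.eq.1 (congrArg Units.val h)

theorem unitPow_sub_one_mem_IA {R : Type*} [CommRing R] {t : ℕ} (ν : Fin t → ℤ) :
    (unitPow R t (Multiplicative.ofAdd ν) : QA R t) - 1 ∈ IA R t := by
  refine prod_zpow_sub_one_mem (fun i => ?_) ν
  rw [unitA, add_sub_cancel_left]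
  exact Ideal.subset_span (Or.inl ⟨i, rfl⟩)

theorem involution_unitPow {R : Type*} [CommRing R] {t : ℕ} {τ : QA R t ≃ₐ[R] QA R t}
    (hτx : ∀ i, τ (xg R t i) = yg R t i) (ν : Fin t → ℤ) :
    τ (unitPow R t (Multiplicative.ofAdd ν)) = unitPow R t (Multiplicative.ofAdd (-ν)) := by
  have hi (i : Fin t) : Units.map (τ : QA R t →* QA R t) (unitA R t i) = (unitA R t i)⁻¹ := by
    ext
    simp [unitA, hτx]
  have h : Units.map (τ : QA R t →* QA R t) (unitPow R t (Multiplicative.ofAdd ν)) =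
      unitPow R t (Multiplicative.ofAdd (-ν)) := by
    simp only [unitPow_ofAdd, map_prod, map_zpow, hi, inv_zpow', Pi.neg_apply]
  exact congrArg Units.val h

open Classical in
/-- A sum over `ℤ^t` splits into the pairs `{ν, -ν}` with `ν` lexicographically positive, and `0`. -/
theorem sum_eq_sum_pos_add_zero {t : ℕ} {B : Type*} [AddCommMonoid B] {s : Finset (Fin t → ℤ)}
    (hs : ∀ ν ∈ s, -ν ∈ s) (h0 : 0 ∈ s) (f : (Fin t → ℤ) → B) :
    ∑ ν ∈ s, f ν = ∑ ν ∈ s with 0 < toLex ν, (f ν + f (-ν)) + f 0 := by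
  have hneg : ∑ ν ∈ s with 0 < toLex ν, f (-ν) = ∑ ν ∈ s with toLex ν < 0, f ν := by
    refine Finset.sum_nbij' (fun ν => -ν) (fun ν => -ν) ?_ ?_ ?_ ?_ ?_
    · intro ν hν
      simp only [Finset.mem_filter] at hν ⊢
      exact ⟨hs _ hν.1, by rw [toLex_neg]; exact neg_lt_zero.2 hν.2⟩
    · intro ν hν
      simp only [Finset.mem_filter] at hν ⊢
      exact ⟨hs _ hν.1, by rw [toLex_neg]; exact neg_pos.2 hν.2⟩
    all_goals simp
  have hrest : s.filter (fun ν => ¬ 0 < toLex ν) =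
      insert 0 (s.filter fun ν => toLex ν < 0) := by
    ext ν
    simp only [Finset.mem_filter, Finset.mem_insert]
    constructor
    · rintro ⟨h, h'⟩
      rcases lt_trichotomy (toLex ν) 0 with h₁ | h₁ | h₁
      exacts [Or.inr ⟨h, h₁⟩, Or.inl h₁, absurd h₁ h']
    · rintro (rfl | ⟨h, h'⟩)
      exacts [⟨h0, lt_irrefl _⟩, ⟨h, lt_asymm h'⟩]
  have hmem : 0 ∉ s.filter (fun ν => toLex ν < 0) := fun h =>
    lt_irrefl _ (Finset.mem_filter.1 h).2
  rw [← Finset.sum_filter_add_sum_filter_not s (fun ν => 0 < toLex ν), hrest,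
    Finset.sum_insert hmem, Finset.sum_add_distrib, hneg, add_assoc, add_comm (f 0)]

theorem exists_traceMap_eq {R : Type*} [CommRing R] {t : ℕ} {τ : QA R t ≃ₐ[R] QA R t}
    (hτx : ∀ i, τ (xg R t i) = yg R t i) (hτy : ∀ i, τ (yg R t i) = xg R t i) {a : QA R t}
    (ha : a ∈ IA R t) (hfix : τ a = a) : ∃ b ∈ IA R t, traceMap τ b = a := by
  classical
  obtain ⟨c, hc⟩ : ∃ c, c = (toLA R t a).coeff := ⟨_, rfl⟩
  have hsymm (ν : Fin t → ℤ) : c (-ν) = c ν := by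
    have h : invLA R t (toLA R t a) = toLA R t a := by rw [← toLA_involution hτx hτy, hfix]
    rw [hc]
    conv_lhs => rw [← h]
    exact Finsupp.mapDomain_apply neg_injective _ ν
  have haug : ∑ ν ∈ insert 0 c.support, c ν = 0 := by
    have h := augLA_toLA ha
    rw [augLA, AddMonoidAlgebra.lift_apply, ← hc,
      Finsupp.sum_of_support_subset c (Finset.subset_insert 0 _) _ (by simp)] at h
    simpa using h
  have hsum : a = ∑ ν ∈ insert 0 c.support,
      c ν • (unitPow R t (Multiplicative.ofAdd ν) : QA R t) := by
    have h := ofLA_toLA a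
    rw [ofLA, AddMonoidAlgebra.lift_apply, ← hc,
      Finsupp.sum_of_support_subset c (Finset.subset_insert 0 _) _ (by simp)] at h
    exact h.symm
  have hs : ∀ ν ∈ insert 0 c.support, -ν ∈ insert 0 c.support := by
    simp [hsymm]
  have h0 := Finset.mem_insert_self 0 c.support
  refine ⟨∑ ν ∈ insert 0 c.support with 0 < toLex ν,
    c ν • ((unitPow R t (Multiplicative.ofAdd ν) : QA R t) - 1),
    sum_mem fun ν _ => Submodule.smul_of_tower_mem _ _ (unitPow_sub_one_mem_IA _), ?_⟩
  have hc0 : (∑ ν ∈ insert 0 c.support with 0 < toLex ν, (c ν + c ν)) + c 0 = 0 := by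
    rw [← haug, sum_eq_sum_pos_add_zero hs h0]
    simp only [hsymm]
  have hone : c 0 • (1 : QA R t) =
      - ∑ ν ∈ insert 0 c.support with 0 < toLex ν, (c ν + c ν) • (1 : QA R t) := by
    rw [← Finset.sum_smul, ← neg_smul, eq_neg_of_add_eq_zero_right hc0]
  conv_rhs => rw [hsum, sum_eq_sum_pos_add_zero hs h0]
  rw [ofAdd_zero, map_one, Units.val_one, hone, ← sub_eq_add_neg, ← Finset.sum_sub_distrib,
    traceMap_apply, map_sum, ← Finset.sum_add_distrib]
  refine Finset.sum_congr rfl fun ν _ => ?_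
  rw [map_smul, map_sub, map_one, involution_unitPow hτx, hsymm]
  module

theorem xpow_coe_eq_prod (R : Type*) [CommRing R] (t : ℕ) (γ : Fin t → Fin 2) :
    xpow R t (fun i => (γ i : ℕ)) = ∏ i with γ i = 1, xg R t i := by
  rw [Finset.prod_filter]
  refine Finset.prod_congr rfl fun i _ => ?_
  obtain h | h : γ i = 0 ∨ γ i = 1 := by omega
  all_goals simp [h]


theorem involution_xpow {R : Type*} [CommRing R] {t : ℕ} {τ : QA R t ≃ₐ[R] QA R t}
    (hτx : ∀ i, τ (xg R t i) = yg R t i) (lam : Fin t → ℕ) :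
    τ (xpow R t lam) = ypow R t lam := by
  simp [xpow, ypow, hτx]

theorem involution_ypow {R : Type*} [CommRing R] {t : ℕ} {τ : QA R t ≃ₐ[R] QA R t}
    (hτy : ∀ i, τ (yg R t i) = xg R t i) (lam : Fin t → ℕ) :
    τ (ypow R t lam) = xpow R t lam := by
  simp [xpow, ypow, hτy]

theorem xpow_mem_IA (R : Type*) [CommRing R] {t : ℕ} {lam : Fin t → ℕ} {i : Fin t}
    (hi : lam i ≠ 0) : xpow R t lam ∈ IA R t :=
  Ideal.mem_of_dvd _ (Finset.dvd_prod_of_mem (fun i => xg R t i ^ lam i) (Finset.mem_univ i))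
    (Ideal.pow_mem_of_mem (IA R t) (Ideal.subset_span (Or.inl ⟨i, rfl⟩)) _ (Nat.pos_of_ne_zero hi))

theorem ypow_mem_IA (R : Type*) [CommRing R] {t : ℕ} {lam : Fin t → ℕ} {i : Fin t}
    (hi : lam i ≠ 0) : ypow R t lam ∈ IA R t :=
  Ideal.mem_of_dvd _ (Finset.dvd_prod_of_mem (fun i => yg R t i ^ lam i) (Finset.mem_univ i))
    (Ideal.pow_mem_of_mem (IA R t) (Ideal.subset_span (Or.inr ⟨i, rfl⟩)) _ (Nat.pos_of_ne_zero hi))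

/-- `I_+ = {a ∈ I_A : τ(a) = a}` is exactly the set of `A_+`-linear combinations
(coefficients fixed by `τ`) of the elements `x^γ + y^γ`, `γ ∈ {0,1}^t − {0}`;
moreover this generating set has `2^t − 1` elements. -/
theorem stmt6 (R : Type*) [CommRing R] (t : ℕ) (ht : 1 ≤ t)
    (τ : QA R t ≃ₐ[R] QA R t)
    (hτx : ∀ i : Fin t, τ (xg R t i) = yg R t i)
    (hτy : ∀ i : Fin t, τ (yg R t i) = xg R t i) :
    ({a : QA R t | a ∈ IA R t ∧ τ a = a} =
      {a : QA R t | ∃ c : (Fin t → Fin 2) → QA R t, (∀ γ, τ (c γ) = c γ) ∧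
        a = ∑ γ ∈ Finset.univ.filter (fun γ : Fin t → Fin 2 => γ ≠ 0),
          c γ * (xpow R t (fun i => (γ i : ℕ)) + ypow R t (fun i => (γ i : ℕ)))}) ∧
    (Finset.univ.filter (fun γ : Fin t → Fin 2 => γ ≠ 0)).card = 2 ^ t - 1 := by
  refine ⟨Set.ext fun a => ⟨?_, ?_⟩, ?_⟩
  · rintro ⟨ha, hfix⟩
    obtain ⟨b, hb, rfl⟩ := exists_traceMap_eq hτx hτy ha hfix
    have hmem : traceMap τ b ∈ Submodule.span (fixedSubalgebra τ)
        ((fun γ : Fin t → Fin 2 => xpow R t (fun i => (γ i : ℕ)) + ypow R t (fun i => (γ i : ℕ))) ''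
          (Finset.univ.filter fun γ : Fin t → Fin 2 => γ ≠ 0)) := by
      refine Submodule.span_mono ?_ (traceMap_mem_span hτx hτy hb)
      rintro _ ⟨S, ⟨j, hj⟩, rfl⟩
      refine ⟨fun i => if i ∈ S then 1 else 0, ?_, ?_⟩
      · simp only [Finset.coe_filter, Finset.mem_univ, true_and, Set.mem_ofPred_eq]
        exact fun h => by simpa [hj] using congrFun h j
      · simp only [← involution_xpow hτx, xpow_coe_eq_prod, traceMap_apply]
        simp
    obtain ⟨c, hc⟩ := (Submodule.mem_span_image_finset_iff_exists_fun' _).1 hmem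
    exact ⟨fun γ => c γ, fun γ => (c γ).2, hc.symm⟩
  · rintro ⟨c, hc, rfl⟩
    refine ⟨sum_mem fun γ hγ => ?_, ?_⟩
    · obtain ⟨i, hi⟩ := Function.ne_iff.1 (Finset.mem_filter.1 hγ).2
      have hi' : (γ i : ℕ) ≠ 0 := fun h => hi (Fin.ext h)
      exact Ideal.mul_mem_left _ _ (add_mem (xpow_mem_IA R hi') (ypow_mem_IA R hi'))
    · simp only [map_sum, map_mul, map_add, hc, involution_xpow hτx, involution_ypow hτy]
      exact Finset.sum_congr rfl fun γ _ => by rw [add_comm (ypow R t _)]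
  · rw [Finset.filter_ne', Finset.card_erase_of_mem (Finset.mem_univ _)]
    simp
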